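/- Let X be an order complete Banach lattice whose normalized atoms form a Schauder basis (x_i) with biorthogonal functionals (x_i*), and set e_n := ∑_{i=1}^n x_i*⊗x_i. Then 𝒜ʳ(X) is a closed order ideal and a closed two-sided algebra ideal of ℒʳ(X), so the quotient 𝔛 := ℒʳ(X)/𝒜ʳ(X) is a Banach lattice ℒʳ(X)-module for the quotient order, norm and module products a·(b + 𝒜ʳ(X)) := ab + 𝒜ʳ(X) and (b + 𝒜ʳ(X))·a := ba + 𝒜ʳ(X). Moreover e_n·x′ = 0 = x′·e_n for every x′ ∈ 𝔛′ and every n ∈ ℕ; in particular sup_n e_n·x′ = 0 = sup_n x′·e_n for every x′ ∈ 𝔛′₊, while ℒʳ(X)·𝔛′ = 𝔛′ = 𝔛′·ℒʳ(X). -/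

import Mathlib

/- STATEMENT 18: 𝒜ʳ(X) is a closed order ideal and closed two-sided algebra ideal of
   ℒʳ(X); on the dual of the quotient 𝔛 = ℒʳ(X)/𝒜ʳ(X) one has e_n·x′ = 0 = x′·e_n
   for all n, while ℒʳ(X)·𝔛′ = 𝔛′ = 𝔛′·ℒʳ(X). -/

open Filter Topology

section Prelude

variable {X : Type*} [NormedAddCommGroup X] [Lattice X] [HasSolidNorm X] [IsOrderedAddMonoid X] [NormedSpace ℝ X]

def IsPosOp (T : X →L[ℝ] X) : Prop := ∀ x : X, 0 ≤ x → 0 ≤ T x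

def opLe (S T : X →L[ℝ] X) : Prop := IsPosOp (T - S)

def LrSet (X : Type*) [NormedAddCommGroup X] [Lattice X] [HasSolidNorm X] [IsOrderedAddMonoid X] [NormedSpace ℝ X] :
    Set (X →L[ℝ] X) :=
  {T | ∃ (n : ℕ) (c : Fin n → ℝ) (S : Fin n → X →L[ℝ] X),
    (∀ i, IsPosOp (S i)) ∧ T = ∑ i, c i • S i}

noncomputable def rnorm (T : X →L[ℝ] X) : ℝ :=
  sInf {c : ℝ | ∃ S : X →L[ℝ] X, ‖S‖ = c ∧ ∀ x : X, |T x| ≤ S |x|}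

def FinRankOp (T : X →L[ℝ] X) : Prop :=
  ∃ (n : ℕ) (f : Fin n → X →L[ℝ] ℝ) (v : Fin n → X), T = ∑ i, (f i).smulRight (v i)

/-- 𝒜ʳ(X): the ‖·‖ᵣ-closure of ℱ(X) in ℒʳ(X). -/
def ArSet (X : Type*) [NormedAddCommGroup X] [Lattice X] [HasSolidNorm X] [IsOrderedAddMonoid X] [NormedSpace ℝ X] :
    Set (X →L[ℝ] X) :=
  {T | T ∈ LrSet X ∧ ∀ ε : ℝ, 0 < ε → ∃ F : X →L[ℝ] X, FinRankOp F ∧ rnorm (T - F) < ε}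

/-- the modulus of T in the operator order of ℒʳ(X). -/
def IsOpAbs (T m : X →L[ℝ] X) : Prop :=
  m ∈ LrSet X ∧ opLe T m ∧ opLe (-T) m ∧
    ∀ c ∈ LrSet X, opLe T c → opLe (-T) c → opLe m c

def IsNormAtom (a : X) : Prop :=
  0 < a ∧ ‖a‖ = 1 ∧ ∀ y : X, 0 ≤ y → y ≤ a → ∃ c : ℝ, y = c • a

/-- Functionals on ℒʳ(X) vanishing on 𝒜ʳ(X); these are exactly the elements of the
dual of the quotient Banach lattice module 𝔛 = ℒʳ(X)/𝒜ʳ(X). -/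
def QuotDual (X : Type*) [NormedAddCommGroup X] [Lattice X] [HasSolidNorm X] [IsOrderedAddMonoid X] [NormedSpace ℝ X]
    (x' : (X →L[ℝ] X) → ℝ) : Prop :=
  (∀ a ∈ LrSet X, ∀ b ∈ LrSet X, x' (a + b) = x' a + x' b) ∧
  (∀ (c : ℝ), ∀ a ∈ LrSet X, x' (c • a) = c * x' a) ∧
  (∃ C : ℝ, ∀ a ∈ LrSet X, |x' a| ≤ C * rnorm a) ∧
  (∀ a ∈ ArSet X, x' a = 0)

end Prelude

section Helpers

set_option linter.unusedSectionVars false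

variable {X : Type*} [NormedAddCommGroup X] [Lattice X] [HasSolidNorm X] [IsOrderedAddMonoid X]
  [NormedSpace ℝ X]

/-- In a real normed lattice, multiplication by nonnegative scalars preserves positivity. -/
lemma real_smul_nonneg {c : ℝ} {x : X} (hc : 0 ≤ c) (hx : 0 ≤ x) : 0 ≤ c • x := by
  have half : ∀ (k n : ℕ), 0 ≤ ((n : ℝ) / 2 ^ k) • x := by
    intro k
    induction k with
    | zero =>
      intro n
      simpa [Nat.cast_smul_eq_nsmul] using nsmul_nonneg hx n
    | succ k ih =>
      intro n
      apply nsmul_two_semiclosed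
      have h : (2 : ℕ) • (((n : ℝ) / 2 ^ (k + 1)) • x) = ((n : ℝ) / 2 ^ k) • x := by
        rw [← Nat.cast_smul_eq_nsmul ℝ, smul_smul]
        congr 1
        push_cast
        field_simp
        ring
      rw [h]
      exact ih n
  have lim : Tendsto (fun k : ℕ => ((⌊c * 2 ^ k⌋₊ : ℝ) / 2 ^ k)) atTop (𝓝 c) :=
    (tendsto_nat_floor_mul_div_atTop hc).comp (tendsto_pow_atTop_atTop_of_one_lt one_lt_two)
  exact ge_of_tendsto' (lim.smul_const x) fun k => half k _

lemma real_smul_le_smul {c d : ℝ} {x : X} (h : c ≤ d) (hx : 0 ≤ x) : c • x ≤ d • x := by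
  rw [← sub_nonneg, ← sub_smul]
  exact real_smul_nonneg (sub_nonneg.2 h) hx

lemma real_smul_le_smul_left {c : ℝ} {x y : X} (hc : 0 ≤ c) (h : x ≤ y) : c • x ≤ c • y := by
  rw [← sub_nonneg, ← smul_sub]
  exact real_smul_nonneg hc (sub_nonneg.2 h)

lemma abs_real_smul_le (c : ℝ) (x : X) : |c • x| ≤ |c| • |x| := by
  rcases le_total 0 c with hc | hc
  · rw [abs_of_nonneg hc]
    refine abs_le'.2 ⟨real_smul_le_smul_left hc (le_abs_self x), ?_⟩
    rw [← smul_neg]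
    exact real_smul_le_smul_left hc (neg_le_abs x)
  · rw [abs_of_nonpos hc]
    have hc' : 0 ≤ -c := neg_nonneg.2 hc
    refine abs_le'.2 ⟨?_, ?_⟩
    · rw [← neg_smul_neg]
      exact real_smul_le_smul_left hc' (neg_le_abs x)
    · rw [← neg_smul]
      exact real_smul_le_smul_left hc' (le_abs_self x)

lemma abs_sum_le_sum_abs_lattice {ι : Type*} (s : Finset ι) (f : ι → X) :
    |∑ i ∈ s, f i| ≤ ∑ i ∈ s, |f i| :=
  Finset.le_sum_of_subadditive _ abs_zero.le abs_add_le s f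

lemma inf_add_le_of_nonneg {a b c : X} (ha : 0 ≤ a) (hb : 0 ≤ b) (hc : 0 ≤ c) :
    (a + b) ⊓ c ≤ a ⊓ c + b ⊓ c := by
  rw [add_inf, inf_add, inf_add]
  refine le_inf (le_inf inf_le_left ?_) (le_inf ?_ ?_)
  · exact inf_le_right.trans (le_add_of_nonneg_right hb)
  · exact inf_le_right.trans (le_add_of_nonneg_left ha)
  · exact inf_le_right.trans (le_add_of_nonneg_left hc)

lemma abs_sum_inf_eq_zero {ι : Type*} (s : Finset ι) (f : ι → X) {a : X} (ha : 0 ≤ a)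
    (h : ∀ i ∈ s, |f i| ⊓ a = 0) : |∑ i ∈ s, f i| ⊓ a = 0 := by
  classical
  induction s using Finset.induction_on with
  | empty => simpa using ha
  | insert i s hi ih =>
    rw [Finset.sum_insert hi]
    refine le_antisymm ?_ (le_inf (abs_nonneg _) ha)
    calc |f i + ∑ j ∈ s, f j| ⊓ a ≤ (|f i| + |∑ j ∈ s, f j|) ⊓ a :=
          inf_le_inf_right _ (abs_add_le _ _)
      _ ≤ |f i| ⊓ a + |∑ j ∈ s, f j| ⊓ a :=
          inf_add_le_of_nonneg (abs_nonneg _) (abs_nonneg _) ha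
      _ = 0 := by
          rw [h i (Finset.mem_insert_self _ _),
            ih fun j hj => h j (Finset.mem_insert_of_mem hj), add_zero]

lemma real_smul_inf_eq_zero {c : ℝ} {a b : X} (ha : 0 ≤ a) (hb : 0 ≤ b) (h : a ⊓ b = 0) :
    |c • a| ⊓ b = 0 := by
  obtain ⟨n, hn⟩ := exists_nat_ge |c|
  have hsum : |∑ _i ∈ Finset.range n, a| ⊓ b = 0 :=
    abs_sum_inf_eq_zero _ _ hb fun _ _ => by rwa [abs_of_nonneg ha]
  refine le_antisymm (le_trans (inf_le_inf_right _ ?_) hsum.le) (le_inf (abs_nonneg _) hb)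
  refine le_trans ?_ (le_abs_self _)
  calc |c • a| ≤ |c| • |a| := abs_real_smul_le c a
    _ ≤ (n : ℝ) • a := by
        rw [abs_of_nonneg ha]
        exact real_smul_le_smul hn ha
    _ = ∑ _i ∈ Finset.range n, a := by simp [Nat.cast_smul_eq_nsmul]

lemma IsPosOp.mono {T : X →L[ℝ] X} (hT : IsPosOp T) {x y : X} (h : x ≤ y) : T x ≤ T y := by
  rw [← sub_nonneg, ← map_sub]
  exact hT _ (sub_nonneg.2 h)

lemma IsPosOp.abs_apply_le {T : X →L[ℝ] X} (hT : IsPosOp T) (x : X) : |T x| ≤ T |x| := by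
  refine abs_le'.2 ⟨hT.mono (le_abs_self x), ?_⟩
  rw [← map_neg]
  exact hT.mono (neg_le_abs x)

lemma IsPosOp.comp {S T : X →L[ℝ] X} (hS : IsPosOp S) (hT : IsPosOp T) : IsPosOp (S ∘L T) :=
  fun x hx => hS _ (hT x hx)

/-- `S` dominates `T`: `|T x| ≤ S |x|` for all `x`. -/
def Dominates (S T : X →L[ℝ] X) : Prop := ∀ x : X, |T x| ≤ S |x|

lemma IsPosOp.dominates {T : X →L[ℝ] X} (hT : IsPosOp T) : Dominates T T := hT.abs_apply_le

lemma Dominates.isPosOp {S T : X →L[ℝ] X} (h : Dominates S T) : IsPosOp S := fun x hx => by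
  simpa [abs_of_nonneg hx] using (abs_nonneg _).trans (h x)

lemma Dominates.add {S T S' T' : X →L[ℝ] X} (h : Dominates S T) (h' : Dominates S' T') :
    Dominates (S + S') (T + T') := fun x =>
  (abs_add_le _ _).trans (add_le_add (h x) (h' x))

lemma Dominates.smul {S T : X →L[ℝ] X} (h : Dominates S T) (c : ℝ) :
    Dominates (|c| • S) (c • T) := fun x =>
  (abs_real_smul_le c (T x)).trans (real_smul_le_smul_left (abs_nonneg c) (h x))

lemma Dominates.comp {S T S' T' : X →L[ℝ] X} (h : Dominates S T) (h' : Dominates S' T') :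
    Dominates (S ∘L S') (T ∘L T') := fun x =>
  (h (T' x)).trans (h.isPosOp.mono (h' x))

lemma dominates_zero : Dominates (0 : X →L[ℝ] X) 0 := fun x => by simp

/-- It suffices to check domination on the positive cone. -/
lemma dominates_of_nonneg {S T : X →L[ℝ] X} (h : ∀ x, 0 ≤ x → |T x| ≤ S x) :
    Dominates S T := fun x => by
  calc |T x| = |T x⁺ - T x⁻| := by rw [← map_sub, posPart_sub_negPart]
    _ ≤ |T x⁺| + |T x⁻| := by simpa [sub_eq_add_neg] using abs_add_le (T x⁺) (-T x⁻)
    _ ≤ S x⁺ + S x⁻ := add_le_add (h _ (posPart_nonneg x)) (h _ (negPart_nonneg x))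
    _ = S |x| := by rw [← map_add, posPart_add_negPart]

lemma rnorm_le_of_dominates {S T : X →L[ℝ] X} (h : Dominates S T) : rnorm T ≤ ‖S‖ :=
  csInf_le ⟨0, by rintro c ⟨S, rfl, -⟩; exact norm_nonneg S⟩ ⟨S, rfl, h⟩

lemma exists_dominates_of_rnorm_lt {T : X →L[ℝ] X} (hT : ∃ S, Dominates S T) {ε : ℝ}
    (h : rnorm T < ε) : ∃ S, Dominates S T ∧ ‖S‖ < ε := by
  obtain ⟨S₀, hS₀⟩ := hT
  obtain ⟨c, ⟨S, rfl, hS⟩, hc⟩ := exists_lt_of_csInf_lt (by exact ⟨‖S₀‖, S₀, rfl, hS₀⟩) h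
  exact ⟨S, hS, hc⟩

lemma mem_LrSet_iff_mem_span {T : X →L[ℝ] X} :
    T ∈ LrSet X ↔ T ∈ Submodule.span ℝ {S : X →L[ℝ] X | IsPosOp S} := by
  rw [Submodule.mem_span_set']
  constructor
  · rintro ⟨n, c, S, hS, rfl⟩
    exact ⟨n, c, fun i => ⟨S i, hS i⟩, rfl⟩
  · rintro ⟨n, c, S, rfl⟩
    exact ⟨n, c, fun i => S i, fun i => (S i).2, rfl⟩

lemma finRankOp_iff_mem_span {T : X →L[ℝ] X} :
    FinRankOp T ↔ T ∈ Submodule.span ℝ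
      {S : X →L[ℝ] X | ∃ (f : X →L[ℝ] ℝ) (v : X), S = f.smulRight v} := by
  rw [Submodule.mem_span_set']
  constructor
  · rintro ⟨n, f, v, rfl⟩
    exact ⟨n, 1, fun i => ⟨(f i).smulRight (v i), f i, v i, rfl⟩, by simp⟩
  · rintro ⟨n, c, S, rfl⟩
    choose f v hfv using fun i => (S i).2
    refine ⟨n, fun i => c i • f i, v, Finset.sum_congr rfl fun i _ => ?_⟩
    rw [hfv]
    ext x
    simp [smul_smul]

lemma IsPosOp.mem_LrSet {T : X →L[ℝ] X} (hT : IsPosOp T) : T ∈ LrSet X :=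
  mem_LrSet_iff_mem_span.2 (Submodule.subset_span hT)

lemma LrSet_add {S T : X →L[ℝ] X} (hS : S ∈ LrSet X) (hT : T ∈ LrSet X) : S + T ∈ LrSet X := by
  rw [mem_LrSet_iff_mem_span] at *
  exact add_mem hS hT

lemma LrSet_sub {S T : X →L[ℝ] X} (hS : S ∈ LrSet X) (hT : T ∈ LrSet X) : S - T ∈ LrSet X := by
  rw [mem_LrSet_iff_mem_span] at *
  exact sub_mem hS hT

lemma LrSet_smul {T : X →L[ℝ] X} (c : ℝ) (hT : T ∈ LrSet X) : c • T ∈ LrSet X := by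
  rw [mem_LrSet_iff_mem_span] at *
  exact Submodule.smul_mem _ c hT

lemma LrSet_comp {S T : X →L[ℝ] X} (hS : S ∈ LrSet X) (hT : T ∈ LrSet X) :
    S ∘L T ∈ LrSet X := by
  rw [mem_LrSet_iff_mem_span] at *
  induction hS using Submodule.span_induction with
  | mem S hS =>
    induction hT using Submodule.span_induction with
    | mem T hT => exact Submodule.subset_span (IsPosOp.comp hS hT)
    | zero => simp
    | add T T' _ _ h h' => rw [ContinuousLinearMap.comp_add]; exact add_mem h h'
    | smul c T _ h => rw [ContinuousLinearMap.comp_smul]; exact Submodule.smul_mem _ c h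
  | zero => simp
  | add S S' _ _ h h' => rw [ContinuousLinearMap.add_comp]; exact add_mem h h'
  | smul c S _ h => rw [ContinuousLinearMap.smul_comp]; exact Submodule.smul_mem _ c h

lemma exists_dominates_of_mem_LrSet {T : X →L[ℝ] X} (hT : T ∈ LrSet X) :
    ∃ S, Dominates S T := by
  rw [mem_LrSet_iff_mem_span] at hT
  induction hT using Submodule.span_induction with
  | mem T hT => exact ⟨T, IsPosOp.dominates hT⟩
  | zero => exact ⟨0, dominates_zero⟩
  | add T T' _ _ h h' =>
    obtain ⟨S, hS⟩ := h
    obtain ⟨S', hS'⟩ := h'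
    exact ⟨_, hS.add hS'⟩
  | smul c T _ h =>
    obtain ⟨S, hS⟩ := h
    exact ⟨_, hS.smul c⟩

lemma FinRankOp.add {S T : X →L[ℝ] X} (hS : FinRankOp S) (hT : FinRankOp T) :
    FinRankOp (S + T) := by
  rw [finRankOp_iff_mem_span] at *
  exact add_mem hS hT

lemma FinRankOp.smul {T : X →L[ℝ] X} (c : ℝ) (hT : FinRankOp T) : FinRankOp (c • T) := by
  rw [finRankOp_iff_mem_span] at *
  exact Submodule.smul_mem _ c hT

lemma FinRankOp.comp_left {T : X →L[ℝ] X} (S : X →L[ℝ] X) (hT : FinRankOp T) :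
    FinRankOp (S ∘L T) := by
  obtain ⟨n, f, v, rfl⟩ := hT
  refine ⟨n, f, fun i => S (v i), ?_⟩
  ext x
  simp

lemma FinRankOp.comp_right {T : X →L[ℝ] X} (S : X →L[ℝ] X) (hT : FinRankOp T) :
    FinRankOp (T ∘L S) := by
  obtain ⟨n, f, v, rfl⟩ := hT
  refine ⟨n, fun i => f i ∘L S, v, ?_⟩
  ext x
  simp

/-- The partial sum projections `e_n` of the basis. -/
noncomputable def basisProj (x : ℕ → X) (xs : ℕ → X →L[ℝ] ℝ) (n : ℕ) : X →L[ℝ] X :=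
  ∑ i ∈ Finset.range n, (xs i).smulRight (x i)

lemma basisProj_apply (x : ℕ → X) (xs : ℕ → X →L[ℝ] ℝ) (n : ℕ) (y : X) :
    basisProj x xs n y = ∑ i ∈ Finset.range n, xs i y • x i := by
  simp [basisProj]

lemma finRankOp_basisProj (x : ℕ → X) (xs : ℕ → X →L[ℝ] ℝ) (n : ℕ) :
    FinRankOp (basisProj x xs n) := by
  rw [finRankOp_iff_mem_span]
  exact sum_mem fun i _ => Submodule.subset_span ⟨xs i, x i, rfl⟩

/-- The sequence `x` consists of normalized atoms and is a Schauder basis with biorthogonal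
functionals `xs`. -/
structure IsAtomicBasis (x : ℕ → X) (xs : ℕ → X →L[ℝ] ℝ) : Prop where
  atom : ∀ i, IsNormAtom (x i)
  biorth : ∀ i j, xs i (x j) = if i = j then (1 : ℝ) else 0
  tendsto : ∀ y : X, Tendsto (fun n => basisProj x xs n y) atTop (𝓝 y)

namespace IsAtomicBasis

variable {x : ℕ → X} {xs : ℕ → X →L[ℝ] ℝ}

lemma nonneg (hB : IsAtomicBasis x xs) (i : ℕ) : 0 ≤ x i := (hB.atom i).1.le

lemma inf_eq_zero (hB : IsAtomicBasis x xs) {i j : ℕ} (hij : i ≠ j) : x i ⊓ x j = 0 := by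
  have h0 : 0 ≤ x i ⊓ x j := le_inf (hB.nonneg i) (hB.nonneg j)
  obtain ⟨c, hc⟩ := (hB.atom i).2.2 _ h0 inf_le_left
  obtain ⟨d, hd⟩ := (hB.atom j).2.2 _ h0 inf_le_right
  have h : xs i (c • x i) = xs i (d • x j) := by rw [← hc, ← hd]
  have hc0 : c = 0 := by simpa [hB.biorth, hij] using h
  rw [hc, hc0, zero_smul]

/-- The coordinate functionals of an atomic basis are positive. -/
lemma coord_nonneg (hB : IsAtomicBasis x xs) (k : ℕ) {y : X} (hy : 0 ≤ y) : 0 ≤ xs k y := by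
  by_contra! hneg
  set z : X := y - xs k y • x k with hz
  have hzx : |z| ⊓ x k = 0 := by
    have hlim : Tendsto (fun n => |basisProj x xs n z| ⊓ x k) atTop (𝓝 (|z| ⊓ x k)) := by
      have hcont : Continuous fun w : X => |w| ⊓ x k := by
        unfold abs
        fun_prop
      exact (hcont.tendsto z).comp (hB.tendsto z)
    refine tendsto_nhds_unique hlim ?_
    have hzero : ∀ n, |basisProj x xs n z| ⊓ x k = 0 := by
      intro n
      rw [basisProj_apply]
      refine abs_sum_inf_eq_zero _ _ (hB.nonneg k) fun i _ => ?_
      rcases eq_or_ne i k with rfl | hik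
      · have : xs i z = 0 := by simp [hz, hB.biorth]
        simpa [this] using hB.nonneg i
      · exact real_smul_inf_eq_zero (hB.nonneg i) (hB.nonneg k) (hB.inf_eq_zero hik)
    simp [hzero]
  have hle : (-xs k y) • x k ≤ |z| := by
    refine le_trans ?_ (le_abs_self z)
    rw [hz, sub_eq_add_neg, ← neg_smul]
    exact le_add_of_nonneg_left hy
  have hm : 0 < min (-xs k y) 1 := lt_min (by linarith) one_pos
  have hmin : (min (-xs k y) 1) • x k ≤ |z| ⊓ x k := by
    refine le_inf ((real_smul_le_smul (min_le_left _ _) (hB.nonneg k)).trans hle) ?_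
    simpa using real_smul_le_smul (min_le_right (-xs k y) 1) (hB.nonneg k)
  rw [hzx] at hmin
  have h0 := le_antisymm hmin (real_smul_nonneg hm.le (hB.nonneg k))
  rcases smul_eq_zero.1 h0 with h | h
  · exact hm.ne' h
  · exact (hB.atom k).1.ne' h

lemma abs_coord_le (hB : IsAtomicBasis x xs) (k : ℕ) (y : X) : |xs k y| ≤ xs k |y| := by
  have h1 := hB.coord_nonneg k (sub_nonneg.2 (le_abs_self y))
  have h2 := hB.coord_nonneg k (sub_nonneg.2 (neg_le_abs y))
  rw [map_sub, sub_nonneg] at h1 h2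
  rw [map_neg] at h2
  exact abs_le'.2 ⟨h1, h2⟩

lemma isPosOp_basisProj (hB : IsAtomicBasis x xs) (n : ℕ) : IsPosOp (basisProj x xs n) := by
  intro y hy
  rw [basisProj_apply]
  exact Finset.sum_nonneg fun i _ => real_smul_nonneg (hB.coord_nonneg i hy) (hB.nonneg i)

lemma basisProj_le (hB : IsAtomicBasis x xs) (n : ℕ) {y : X} (hy : 0 ≤ y) :
    basisProj x xs n y ≤ y := by
  refine ge_of_tendsto (hB.tendsto y) ?_
  filter_upwards [eventually_ge_atTop n] with m hm
  rw [basisProj_apply, basisProj_apply]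
  exact Finset.sum_le_sum_of_subset_of_nonneg (Finset.range_mono hm) fun i _ _ =>
    real_smul_nonneg (hB.coord_nonneg i hy) (hB.nonneg i)

/-- Every continuous functional is dominated by a positive one. -/
lemma exists_abs_functional (hB : IsAtomicBasis x xs) (f : X →L[ℝ] ℝ) :
    ∃ g : X →L[ℝ] ℝ, ∀ y, |f y| ≤ g |y| := by
  have hpart : ∀ y, 0 ≤ y → ∀ n, ∑ i ∈ Finset.range n, |f (x i)| * xs i y ≤ ‖f‖ * ‖y‖ := by
    intro y hy n
    set w : X := ∑ i ∈ Finset.range n, (SignType.sign (f (x i)) : ℝ) • xs i y • x i with hw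
    have hfw : f w = ∑ i ∈ Finset.range n, |f (x i)| * xs i y := by
      rw [hw, map_sum]
      refine Finset.sum_congr rfl fun i _ => ?_
      rw [map_smul, map_smul, smul_eq_mul, smul_eq_mul, ← sign_mul_self (f (x i))]
      ring
    have hwy : |w| ≤ y := by
      refine le_trans ?_ (hB.basisProj_le n hy)
      rw [hw, basisProj_apply]
      refine (abs_sum_le_sum_abs_lattice _ _).trans (Finset.sum_le_sum fun i _ => ?_)
      have hp := real_smul_nonneg (hB.coord_nonneg i hy) (hB.nonneg i)
      refine (abs_real_smul_le _ _).trans ?_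
      rw [abs_of_nonneg hp]
      have h1 : |((SignType.sign (f (x i)) : SignType) : ℝ)| ≤ 1 := by
        rcases SignType.sign (f (x i)) with _ | _ | _ <;> simp
      simpa using real_smul_le_smul h1 hp
    calc ∑ i ∈ Finset.range n, |f (x i)| * xs i y = f w := hfw.symm
      _ ≤ ‖f w‖ := Real.le_norm_self _
      _ ≤ ‖f‖ * ‖w‖ := f.le_opNorm w
      _ ≤ ‖f‖ * ‖y‖ := by
          gcongr
          exact norm_le_norm_of_abs_le_abs (by rwa [abs_of_nonneg hy])
  have hnn : ∀ y, 0 ≤ y → ∀ i, 0 ≤ |f (x i)| * xs i y := fun y hy i =>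
    mul_nonneg (abs_nonneg _) (hB.coord_nonneg i hy)
  have hsumm₀ : ∀ y, 0 ≤ y → Summable fun i => |f (x i)| * xs i y := fun y hy =>
    summable_of_sum_range_le (hnn y hy) (hpart y hy)
  have hbd : ∀ y i, ‖|f (x i)| * xs i y‖ ≤ |f (x i)| * xs i |y| := by
    intro y i
    rw [norm_mul, Real.norm_eq_abs, abs_abs, Real.norm_eq_abs]
    exact mul_le_mul_of_nonneg_left (hB.abs_coord_le i y) (abs_nonneg _)
  have hsumm : ∀ y, Summable fun i => |f (x i)| * xs i y := fun y =>
    Summable.of_norm_bounded (hsumm₀ |y| (abs_nonneg y)) (hbd y)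
  let g₀ : X →ₗ[ℝ] ℝ :=
    { toFun := fun y => ∑' i, |f (x i)| * xs i y
      map_add' := fun y z => by
        rw [← (hsumm y).tsum_add (hsumm z)]
        simp [mul_add]
      map_smul' := fun c y => by
        rw [RingHom.id_apply, smul_eq_mul, ← tsum_mul_left]
        simp [mul_left_comm] }
  refine ⟨g₀.mkContinuous ‖f‖ fun y => ?_, fun y => ?_⟩
  · calc ‖g₀ y‖ ≤ ∑' i, |f (x i)| * xs i |y| :=
          tsum_of_norm_bounded (hsumm₀ |y| (abs_nonneg y)).hasSum (hbd y)
      _ ≤ ‖f‖ * ‖|y|‖ :=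
          (hsumm₀ |y| (abs_nonneg y)).tsum_le_of_sum_range_le (hpart |y| (abs_nonneg y))
      _ = ‖f‖ * ‖y‖ := by rw [norm_abs_eq_norm]
  · have hlim : Tendsto (fun n => |f (basisProj x xs n y)|) atTop (𝓝 |f y|) :=
      ((f.continuous.tendsto y).comp (hB.tendsto y)).abs
    refine le_of_tendsto' hlim fun n => ?_
    calc |f (basisProj x xs n y)| = |∑ i ∈ Finset.range n, xs i y * f (x i)| := by
          simp [basisProj_apply]
      _ ≤ ∑ i ∈ Finset.range n, |xs i y * f (x i)| := Finset.abs_sum_le_sum_abs _ _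
      _ ≤ ∑ i ∈ Finset.range n, |f (x i)| * xs i |y| := by
          refine Finset.sum_le_sum fun i _ => ?_
          rw [abs_mul, mul_comm]
          exact mul_le_mul_of_nonneg_left (hB.abs_coord_le i y) (abs_nonneg _)
      _ ≤ ∑' i, |f (x i)| * xs i |y| :=
          (hsumm₀ |y| (abs_nonneg y)).sum_le_tsum _ fun i _ => hnn _ (abs_nonneg y) i

lemma dominates_smulRight {f g : X →L[ℝ] ℝ} (hfg : ∀ y, |f y| ≤ g |y|) (v : X) :
    Dominates (g.smulRight |v|) (f.smulRight v) := fun y => by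
  simp only [ContinuousLinearMap.smulRight_apply]
  exact (abs_real_smul_le _ _).trans (real_smul_le_smul (hfg y) (abs_nonneg v))

lemma mem_LrSet_of_finRankOp (hB : IsAtomicBasis x xs) {F : X →L[ℝ] X} (hF : FinRankOp F) :
    F ∈ LrSet X := by
  rw [finRankOp_iff_mem_span] at hF
  rw [mem_LrSet_iff_mem_span]
  refine Submodule.span_le.2 ?_ hF
  rintro _ ⟨f, v, rfl⟩
  obtain ⟨g, hg⟩ := hB.exists_abs_functional f
  have hdom := dominates_smulRight hg v
  have hsub : IsPosOp (g.smulRight |v| - f.smulRight v) := fun y hy => by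
    rw [sub_apply, sub_nonneg]
    simpa only [abs_of_nonneg hy] using (le_abs_self _).trans (hdom y)
  rw [← sub_sub_cancel (g.smulRight |v|) (f.smulRight v)]
  exact mem_LrSet_iff_mem_span.1 (LrSet_sub hdom.isPosOp.mem_LrSet hsub.mem_LrSet)

/-- For finite rank `F`, the operators `e_n F` converge to `F` in the regular norm. -/
lemma exists_dominates_sub_basisProj_comp (hB : IsAtomicBasis x xs) {F : X →L[ℝ] X}
    (hF : FinRankOp F) : ∃ R : ℕ → X →L[ℝ] X,
      (∀ n, Dominates (R n) (F - basisProj x xs n ∘L F)) ∧ Tendsto R atTop (𝓝 0) := by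
  rw [finRankOp_iff_mem_span] at hF
  induction hF using Submodule.span_induction with
  | mem F hF =>
    obtain ⟨f, v, rfl⟩ := hF
    obtain ⟨g, hg⟩ := hB.exists_abs_functional f
    refine ⟨fun n => g.smulRight |v - basisProj x xs n v|, fun n => ?_, ?_⟩
    · have h : f.smulRight v - basisProj x xs n ∘L f.smulRight v
          = f.smulRight (v - basisProj x xs n v) := by
        ext y
        simp [smul_sub]
      rw [h]
      exact dominates_smulRight hg _
    · rw [tendsto_zero_iff_norm_tendsto_zero]
      simp only [ContinuousLinearMap.norm_smulRight_apply, norm_abs_eq_norm]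
      have h := ((tendsto_const_nhds (x := v)).sub (hB.tendsto v)).norm.const_mul ‖g‖
      simpa using h
  | zero => exact ⟨fun _ => 0, fun n => by simpa using dominates_zero, tendsto_const_nhds⟩
  | add F F' _ _ h h' =>
    obtain ⟨R, hR, hR0⟩ := h
    obtain ⟨R', hR', hR0'⟩ := h'
    refine ⟨fun n => R n + R' n, fun n => ?_, by simpa using hR0.add hR0'⟩
    have h := (hR n).add (hR' n)
    rwa [sub_add_sub_comm, ← ContinuousLinearMap.comp_add] at h
  | smul c F _ h =>
    obtain ⟨R, hR, hR0⟩ := h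
    refine ⟨fun n => |c| • R n, fun n => ?_, by simpa using hR0.const_smul |c|⟩
    have h := (hR n).smul c
    rwa [smul_sub, ← ContinuousLinearMap.comp_smul] at h

lemma mem_ArSet_iff (hB : IsAtomicBasis x xs) {T : X →L[ℝ] X} :
    T ∈ ArSet X ↔ T ∈ LrSet X ∧ ∀ ε : ℝ, 0 < ε →
      ∃ F S : X →L[ℝ] X, FinRankOp F ∧ Dominates S (T - F) ∧ ‖S‖ < ε := by
  refine and_congr_right fun hT => forall₂_congr fun ε _ => ⟨?_, ?_⟩
  · rintro ⟨F, hF, hlt⟩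
    obtain ⟨S, hS, hSε⟩ := exists_dominates_of_rnorm_lt
      (exists_dominates_of_mem_LrSet (LrSet_sub hT (hB.mem_LrSet_of_finRankOp hF))) hlt
    exact ⟨F, S, hF, hS, hSε⟩
  · rintro ⟨F, S, hF, hS, hSε⟩
    exact ⟨F, hF, (rnorm_le_of_dominates hS).trans_lt hSε⟩

lemma mem_ArSet_of_finRankOp (hB : IsAtomicBasis x xs) {F : X →L[ℝ] X} (hF : FinRankOp F) :
    F ∈ ArSet X :=
  hB.mem_ArSet_iff.2 ⟨hB.mem_LrSet_of_finRankOp hF, fun ε hε =>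
    ⟨F, 0, hF, by simpa using dominates_zero, by simpa using hε⟩⟩

lemma ArSet_add (hB : IsAtomicBasis x xs) {a b : X →L[ℝ] X} (ha : a ∈ ArSet X)
    (hb : b ∈ ArSet X) : a + b ∈ ArSet X := by
  rw [hB.mem_ArSet_iff] at *
  refine ⟨LrSet_add ha.1 hb.1, fun ε hε => ?_⟩
  obtain ⟨F, S, hF, hS, hSε⟩ := ha.2 (ε / 2) (half_pos hε)
  obtain ⟨F', S', hF', hS', hSε'⟩ := hb.2 (ε / 2) (half_pos hε)
  refine ⟨F + F', S + S', hF.add hF', ?_, ?_⟩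
  · rw [add_sub_add_comm]
    exact hS.add hS'
  · linarith [norm_add_le S S']

lemma ArSet_smul (hB : IsAtomicBasis x xs) (c : ℝ) {a : X →L[ℝ] X} (ha : a ∈ ArSet X) :
    c • a ∈ ArSet X := by
  rw [hB.mem_ArSet_iff] at *
  refine ⟨LrSet_smul c ha.1, fun ε hε => ?_⟩
  obtain ⟨F, S, hF, hS, hSε⟩ := ha.2 (ε / (|c| + 1)) (by positivity)
  refine ⟨c • F, |c| • S, hF.smul c, ?_, ?_⟩
  · rw [← smul_sub]
    exact hS.smul c
  · rw [lt_div_iff₀ (by positivity)] at hSε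
    rw [norm_smul, Real.norm_eq_abs, abs_abs]
    nlinarith [norm_nonneg S]

lemma ArSet_comp_left (hB : IsAtomicBasis x xs) {a T : X →L[ℝ] X} (ha : a ∈ ArSet X)
    (hT : T ∈ LrSet X) : T ∘L a ∈ ArSet X := by
  rw [hB.mem_ArSet_iff] at *
  refine ⟨LrSet_comp hT ha.1, fun ε hε => ?_⟩
  obtain ⟨R, hR⟩ := exists_dominates_of_mem_LrSet hT
  obtain ⟨F, S, hF, hS, hSε⟩ := ha.2 (ε / (‖R‖ + 1)) (by positivity)
  refine ⟨T ∘L F, R ∘L S, hF.comp_left T, ?_, ?_⟩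
  · rw [← ContinuousLinearMap.comp_sub]
    exact hR.comp hS
  · rw [lt_div_iff₀ (by positivity)] at hSε
    nlinarith [norm_nonneg S, R.opNorm_comp_le S]

lemma ArSet_comp_right (hB : IsAtomicBasis x xs) {a T : X →L[ℝ] X} (ha : a ∈ ArSet X)
    (hT : T ∈ LrSet X) : a ∘L T ∈ ArSet X := by
  rw [hB.mem_ArSet_iff] at *
  refine ⟨LrSet_comp ha.1 hT, fun ε hε => ?_⟩
  obtain ⟨R, hR⟩ := exists_dominates_of_mem_LrSet hT
  obtain ⟨F, S, hF, hS, hSε⟩ := ha.2 (ε / (‖R‖ + 1)) (by positivity)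
  refine ⟨F ∘L T, S ∘L R, hF.comp_right T, ?_, ?_⟩
  · rw [← ContinuousLinearMap.sub_comp]
    exact hS.comp hR
  · rw [lt_div_iff₀ (by positivity)] at hSε
    nlinarith [norm_nonneg S, S.opNorm_comp_le R]

lemma ArSet_closed (hB : IsAtomicBasis x xs) {T : X →L[ℝ] X} (hT : T ∈ LrSet X)
    (h : ∀ ε : ℝ, 0 < ε → ∃ a ∈ ArSet X, rnorm (T - a) < ε) : T ∈ ArSet X := by
  refine hB.mem_ArSet_iff.2 ⟨hT, fun ε hε => ?_⟩
  obtain ⟨a, ha, hTa⟩ := h (ε / 2) (half_pos hε)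
  obtain ⟨S, hS, hSε⟩ := exists_dominates_of_rnorm_lt
    (exists_dominates_of_mem_LrSet (LrSet_sub hT ha.1)) hTa
  obtain ⟨F, S', hF, hS', hSε'⟩ := (hB.mem_ArSet_iff.1 ha).2 (ε / 2) (half_pos hε)
  refine ⟨F, S + S', hF, ?_, ?_⟩
  · simpa using hS.add hS'
  · linarith [norm_add_le S S']

/-- The complementary projections `1 - e_n` are positive. -/
lemma isPosOp_id_sub_basisProj (hB : IsAtomicBasis x xs) (n : ℕ) :
    IsPosOp (ContinuousLinearMap.id ℝ X - basisProj x xs n) := fun y hy => by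
  simpa using hB.basisProj_le n hy

lemma norm_id_sub_basisProj_apply_le (hB : IsAtomicBasis x xs) (n : ℕ) (y : X) :
    ‖(ContinuousLinearMap.id ℝ X - basisProj x xs n) y‖ ≤ ‖y‖ := by
  refine norm_le_norm_of_abs_le_abs (((hB.isPosOp_id_sub_basisProj n).abs_apply_le y).trans ?_)
  simpa using hB.isPosOp_basisProj n _ (abs_nonneg y)

lemma basisProj_basisProj (hB : IsAtomicBasis x xs) (n : ℕ) (y : X) :
    basisProj x xs n (basisProj x xs n y) = basisProj x xs n y := by
  rw [basisProj_apply x xs n (basisProj x xs n y), basisProj_apply x xs n y]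
  refine Finset.sum_congr rfl fun i hi => ?_
  congr 1
  simp [hB.biorth, Finset.mem_range.1 hi]

/-- For `a ∈ 𝒜ʳ(X)`, the operators `e_n a` converge to `a` in the regular norm. -/
lemma exists_dominates_sub_basisProj_comp_of_mem_ArSet (hB : IsAtomicBasis x xs)
    {a : X →L[ℝ] X} (ha : a ∈ ArSet X) {ε : ℝ} (hε : 0 < ε) :
    ∃ (n : ℕ) (S : X →L[ℝ] X), Dominates S (a - basisProj x xs n ∘L a) ∧ ‖S‖ < ε := by
  obtain ⟨F, S, hF, hS, hSε⟩ := (hB.mem_ArSet_iff.1 ha).2 (ε / 2) (half_pos hε)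
  obtain ⟨R, hR, hR0⟩ := hB.exists_dominates_sub_basisProj_comp hF
  obtain ⟨n, hn⟩ := ((tendsto_zero_iff_norm_tendsto_zero.1 hR0).eventually_lt_const
    (half_pos hε)).exists
  set Q := ContinuousLinearMap.id ℝ X - basisProj x xs n with hQ
  have hQS := ((hB.isPosOp_id_sub_basisProj n).dominates.comp hS).add (hR n)
  refine ⟨n, Q ∘L S + R n, ?_, ?_⟩
  · convert hQS using 1
    ext y
    simp
  · have hle : ‖Q ∘L S‖ ≤ ‖S‖ := ContinuousLinearMap.opNorm_le_bound _ (norm_nonneg S) fun y =>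
      (hB.norm_id_sub_basisProj_apply_le n (S y)).trans (S.le_opNorm y)
    linarith [norm_add_le (Q ∘L S) (R n)]

lemma ArSet_order_ideal (hB : IsAtomicBasis x xs) {T a mT mA : X →L[ℝ] X} (hT : T ∈ LrSet X)
    (ha : a ∈ ArSet X) (hmT : IsOpAbs T mT) (hmA : IsOpAbs a mA) (hle : opLe mT mA) :
    T ∈ ArSet X := by
  refine hB.mem_ArSet_iff.2 ⟨hT, fun ε hε => ?_⟩
  obtain ⟨n, S, hS, hSε⟩ := hB.exists_dominates_sub_basisProj_comp_of_mem_ArSet ha hε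
  refine ⟨basisProj x xs n ∘L T, S, (finRankOp_basisProj x xs n).comp_right T, ?_, hSε⟩
  set P := basisProj x xs n
  set Q := ContinuousLinearMap.id ℝ X - P with hQ
  have hPpos : IsPosOp P := hB.isPosOp_basisProj n
  have hQpos : IsPosOp Q := hB.isPosOp_id_sub_basisProj n
  have hSpos : IsPosOp S := hS.isPosOp
  have hPP : ∀ y, P (P y) = P y := hB.basisProj_basisProj n
  have hQP : ∀ y, Q (P y) = 0 := fun y => by simp [hQ, hPP]
  have hQQ : ∀ y, Q (Q y) = Q y := fun y => by
    rw [hQ, sub_apply, ← hQ]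
    have : P (Q y) = 0 := by simp [hQ, hPP]
    simp [this]
  have hdec : ∀ y, P y + Q y = y := fun y => by simp [hQ]
  have hub : ∀ y, 0 ≤ y → |a y| ≤ mA y := fun y hy => by
    refine abs_le'.2 ⟨?_, ?_⟩
    · simpa using hmA.2.1 y hy
    · simpa [neg_le_iff_add_nonneg] using hmA.2.2.1 y hy
  have hubT : ∀ y, 0 ≤ y → |T y| ≤ mT y := fun y hy => by
    refine abs_le'.2 ⟨?_, ?_⟩
    · simpa using hmT.2.1 y hy
    · simpa [neg_le_iff_add_nonneg] using hmT.2.2.1 y hy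
  have hQa : ∀ y, 0 ≤ y → |Q (a y)| ≤ S y := fun y hy => by
    simpa [hQ, abs_of_nonneg hy] using hS y
  have hbound : ∀ y, 0 ≤ y → |a y| ≤ P (mA y) + Q (S y) := fun y hy => by
    calc |a y| = |P (a y) + Q (Q (a y))| := by rw [hQQ, hdec]
      _ ≤ |P (a y)| + |Q (Q (a y))| := abs_add_le _ _
      _ ≤ P (mA y) + Q (S y) := add_le_add
          ((hPpos.abs_apply_le _).trans (hPpos.mono (hub y hy)))
          ((hQpos.abs_apply_le _).trans (hQpos.mono (hQa y hy)))
  have hmin : opLe mA (P ∘L mA + Q ∘L S) := by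
    refine hmA.2.2.2 _ (LrSet_add (LrSet_comp hPpos.mem_LrSet hmA.1)
      (hQpos.comp hSpos).mem_LrSet) (fun y hy => ?_) fun y hy => ?_
    · simpa using (le_abs_self _).trans (hbound y hy)
    · simpa [neg_le_iff_add_nonneg] using (neg_le_abs _).trans (hbound y hy)
  refine dominates_of_nonneg fun y hy => ?_
  have h1 : mT y ≤ mA y := by simpa using hle y hy
  have h2 : mA y ≤ P (mA y) + Q (S y) := by simpa using hmin y hy
  calc |(T - P ∘L T) y| = |Q (T y)| := by simp [hQ]
    _ ≤ Q |T y| := hQpos.abs_apply_le _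
    _ ≤ Q (P (mA y) + Q (S y)) := hQpos.mono (((hubT y hy).trans h1).trans h2)
    _ = Q (S y) := by rw [map_add, hQP, hQQ, zero_add]
    _ ≤ S y := by simpa [hQ] using hPpos _ (hSpos y hy)

end IsAtomicBasis

end Helpers

theorem quotient_module_kills_en
    {X : Type*} [NormedAddCommGroup X] [Lattice X] [HasSolidNorm X] [IsOrderedAddMonoid X] [NormedSpace ℝ X] [CompleteSpace X]
    -- X is order complete:
    (hXoc : ∀ S : Set X, S.Nonempty → BddAbove S → ∃ b, IsLUB S b)
    -- the normalized atoms of X form a Schauder basis (x i), biorthogonal (xs i):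
    (x : ℕ → X) (xs : ℕ → X →L[ℝ] ℝ)
    (hatom : ∀ i, IsNormAtom (x i))
    (hall : ∀ a : X, IsNormAtom a → ∃ i, x i = a)
    (hbi : ∀ i j, xs i (x j) = if i = j then (1 : ℝ) else 0)
    (hbasis : ∀ y : X, Tendsto (fun n => ∑ i ∈ Finset.range n, xs i y • x i) atTop (𝓝 y)) :
    -- (1) 𝒜ʳ(X) is a closed order ideal and closed two-sided algebra ideal of ℒʳ(X):
    (ArSet X ⊆ LrSet X) ∧
    (∀ a ∈ ArSet X, ∀ b ∈ ArSet X, a + b ∈ ArSet X) ∧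
    (∀ (c : ℝ), ∀ a ∈ ArSet X, c • a ∈ ArSet X) ∧
    (∀ T ∈ LrSet X, ∀ a ∈ ArSet X, ∀ mT mA : X →L[ℝ] X,
      IsOpAbs T mT → IsOpAbs a mA → opLe mT mA → T ∈ ArSet X) ∧
    (∀ a ∈ ArSet X, ∀ T ∈ LrSet X, T ∘L a ∈ ArSet X ∧ a ∘L T ∈ ArSet X) ∧
    (∀ T ∈ LrSet X, (∀ ε : ℝ, 0 < ε → ∃ a ∈ ArSet X, rnorm (T - a) < ε) → T ∈ ArSet X) ∧
    -- (2) on the dual of the quotient module, e_n·x′ = 0 = x′·e_n for every n,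
    --     (here (e_n·x′)(b) = x′(b ∘ e_n) and (x′·e_n)(b) = x′(e_n ∘ b)):
    (∀ x' : (X →L[ℝ] X) → ℝ, QuotDual X x' → ∀ n : ℕ, ∀ b ∈ LrSet X,
      x' (b ∘L (∑ i ∈ Finset.range n, (xs i).smulRight (x i))) = 0 ∧
      x' ((∑ i ∈ Finset.range n, (xs i).smulRight (x i)) ∘L b) = 0) ∧
    -- (3) ℒʳ(X)·𝔛′ = 𝔛′ = 𝔛′·ℒʳ(X):
    (∀ x' : (X →L[ℝ] X) → ℝ, QuotDual X x' →
      (∃ a ∈ LrSet X, ∃ y' : (X →L[ℝ] X) → ℝ, QuotDual X y' ∧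
        ∀ b ∈ LrSet X, x' b = y' (b ∘L a)) ∧
      (∃ a ∈ LrSet X, ∃ y' : (X →L[ℝ] X) → ℝ, QuotDual X y' ∧
        ∀ b ∈ LrSet X, x' b = y' (a ∘L b))) := by
  have hB : IsAtomicBasis x xs :=
    ⟨hatom, hbi, fun y => by simpa only [basisProj_apply] using hbasis y⟩
  refine ⟨fun T hT => hT.1, fun a ha b hb => hB.ArSet_add ha hb,
    fun c a ha => hB.ArSet_smul c ha,
    fun T hT a ha mT mA hmT hmA hle => hB.ArSet_order_ideal hT ha hmT hmA hle,
    fun a ha T hT => ⟨hB.ArSet_comp_left ha hT, hB.ArSet_comp_right ha hT⟩,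
    fun T hT h => hB.ArSet_closed hT h, ?_, ?_⟩
  · intro x' hx' n b _
    have he := finRankOp_basisProj x xs n
    exact ⟨hx'.2.2.2 _ (hB.mem_ArSet_of_finRankOp (he.comp_left b)),
      hx'.2.2.2 _ (hB.mem_ArSet_of_finRankOp (he.comp_right b))⟩
  · intro x' hx'
    have hid : ContinuousLinearMap.id ℝ X ∈ LrSet X :=
      IsPosOp.mem_LrSet fun y hy => by simpa using hy
    exact ⟨⟨_, hid, x', hx', fun b _ => by simp⟩, ⟨_, hid, x', hx', fun b _ => by simp⟩⟩
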